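/- Let N be a nonnegative integer and let q, a, b, t be complex numbers such that q^i ≠ 1 for 1 ≤ i ≤ N and a·t·q^i ≠ 1 for 1 ≤ i ≤ N. Then Σ_{k=0}^{N} (bt)^k q^{k(k+1)/2} / (atq;q)_k · [N choose k]_q = Σ_{m=0}^{N} (bt)^m q^{m(m+1)/2} · (−btq^{m+1};q)_{N−m} · (at)^m q^{m²} / (atq;q)_m · [N choose m]_q. -/

import Mathlib

open scoped BigOperators

/-- The finite q-Pochhammer symbol `(a;q)_n = ∏_{i=0}^{n-1} (1 - a q^i)`. -/
noncomputable def qPoch (a q : ℂ) (n : ℕ) : ℂ := ∏ i ∈ Finset.range n, (1 - a * q ^ i)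

/-- The Gaussian (q-binomial) coefficient `[n choose k]_q`, equal to
`(q;q)_n / ((q;q)_{n-k} (q;q)_k)` when `0 ≤ k ≤ n` and `0` otherwise. -/
noncomputable def qBinom (q : ℂ) (n k : ℤ) : ℂ :=
  if 0 ≤ k ∧ k ≤ n then
    qPoch q q n.toNat / (qPoch q q (n - k).toNat * qPoch q q k.toNat)
  else 0

theorem qPoch_succ (a q : ℂ) (n : ℕ) : qPoch a q (n + 1) = qPoch a q n * (1 - a * q ^ n) :=
  Finset.prod_range_succ _ _

theorem qPoch_succ_left (a q : ℂ) (n : ℕ) :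
    qPoch a q (n + 1) = (1 - a) * qPoch (a * q) q n := by
  simp only [qPoch, Finset.prod_range_succ', pow_zero, mul_one]
  rw [mul_comm]
  congr 1
  exact Finset.prod_congr rfl fun i _ => by ring

theorem qPoch_mul_self_ne_zero {a q : ℂ} {n : ℕ}
    (h : ∀ i : ℕ, 1 ≤ i → i ≤ n → a * q ^ i ≠ 1) : qPoch (a * q) q n ≠ 0 := by
  refine Finset.prod_ne_zero_iff.2 fun i hi => sub_ne_zero.2 fun h1 => ?_
  refine h (i + 1) (by omega) (by have := Finset.mem_range.1 hi; omega) ?_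
  rw [h1]
  ring

theorem qPoch_self_ne_zero {q : ℂ} {n : ℕ} (h : ∀ i : ℕ, 1 ≤ i → i ≤ n → q ^ i ≠ 1) :
    qPoch q q n ≠ 0 := by
  simpa using qPoch_mul_self_ne_zero (a := 1) (q := q) (n := n) (by simpa using h)

theorem qBinom_add (q : ℂ) (d k : ℕ) :
    qBinom q ((k + d : ℕ) : ℤ) k = qPoch q q (k + d) / (qPoch q q d * qPoch q q k) := by
  have h : (((k + d : ℕ) : ℤ) - k).toNat = d := by omega
  rw [qBinom, if_pos (by omega), h, Int.toNat_natCast, Int.toNat_natCast]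

theorem qBinom_of_lt (q : ℂ) {n k : ℕ} (h : n < k) : qBinom q n k = 0 :=
  if_neg (by omega)

theorem qBinom_zero_right {q : ℂ} {n : ℕ} (h : qPoch q q n ≠ 0) :
    qBinom q n ((0 : ℕ) : ℤ) = 1 := by
  have := qBinom_add q n 0
  rw [zero_add] at this
  rw [this]
  rw [show qPoch q q 0 = 1 from Finset.prod_range_zero _]
  simp [h]

theorem qBinom_self {q : ℂ} {n : ℕ} (h : qPoch q q n ≠ 0) : qBinom q n n = 1 := by
  have := qBinom_add q 0 n
  rw [add_zero] at this
  rw [this]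
  rw [show qPoch q q 0 = 1 from Finset.prod_range_zero _]
  simp [h]

/-- The `q`-Pascal recurrence. -/
theorem qBinom_succ_succ {q : ℂ} {n : ℕ} (hq : ∀ i : ℕ, 1 ≤ i → i ≤ n + 1 → q ^ i ≠ 1) (k : ℕ) :
    qBinom q ((n + 1 : ℕ) : ℤ) ((k + 1 : ℕ) : ℤ) =
      q ^ (k + 1) * qBinom q n ((k + 1 : ℕ) : ℤ) + qBinom q n k := by
  have hP : ∀ j ≤ n + 1, qPoch q q j ≠ 0 := fun j hj =>
    qPoch_self_ne_zero fun i h1 h2 => hq i h1 (h2.trans hj)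
  rcases lt_trichotomy n k with h | rfl | h
  · rw [qBinom_of_lt q h, qBinom_of_lt q (show n + 1 < k + 1 by omega),
      qBinom_of_lt q (show n < k + 1 by omega)]
    ring
  · rw [qBinom_self (hP _ le_rfl), qBinom_self (hP _ (by omega)), qBinom_of_lt q n.lt_succ_self]
    ring
  · obtain ⟨d, rfl⟩ := Nat.exists_eq_add_of_le (show k + 1 ≤ n from h)
    have e1 := qBinom_add q (d + 1) (k + 1)
    have e2 := qBinom_add q d (k + 1)
    have e3 := qBinom_add q (d + 1) k
    rw [show k + 1 + (d + 1) = k + 1 + d + 1 by ring] at e1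
    rw [show k + (d + 1) = k + 1 + d by ring] at e3
    rw [e1, e2, e3]
    have hk := hP (k + 1) (by omega)
    have hd := hP (d + 1) (by omega)
    rw [qPoch_succ q q (k + 1 + d), qPoch_succ q q d, qPoch_succ q q k]
    rw [qPoch_succ] at hk hd
    obtain ⟨hk1, hk2⟩ := mul_ne_zero_iff.1 hk
    obtain ⟨hd1, hd2⟩ := mul_ne_zero_iff.1 hd
    field_simp
    ring

theorem sum_mul_qBinom_succ {q : ℂ} {n : ℕ} (hq : ∀ i : ℕ, 1 ≤ i → i ≤ n + 1 → q ^ i ≠ 1)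
    (f : ℕ → ℂ) :
    ∑ k ∈ Finset.range (n + 2), f k * qBinom q ((n + 1 : ℕ) : ℤ) k =
      ∑ k ∈ Finset.range (n + 1), (q ^ k * f k + f (k + 1)) * qBinom q n k := by
  have h0 : ∑ k ∈ Finset.range (n + 1), q ^ k * f k * qBinom q n k =
      ∑ k ∈ Finset.range (n + 2), q ^ k * f k * qBinom q n k := by
    rw [Finset.sum_range_succ _ (n + 1), qBinom_of_lt q n.lt_succ_self, mul_zero, add_zero]
  simp only [add_mul, Finset.sum_add_distrib]
  rw [h0, Finset.sum_range_succ', Finset.sum_range_succ' _ (n + 1),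
    qBinom_zero_right (qPoch_self_ne_zero hq),
    qBinom_zero_right (qPoch_self_ne_zero fun i h1 h2 => hq i h1 (by omega))]
  simp only [qBinom_succ_succ hq, mul_add, Finset.sum_add_distrib]
  have : ∀ k : ℕ, f (k + 1) * (q ^ (k + 1) * qBinom q n ((k + 1 : ℕ) : ℤ)) =
      q ^ (k + 1) * f (k + 1) * qBinom q n ((k + 1 : ℕ) : ℤ) := fun k => by ring
  simp only [this]
  ring

theorem triangular_succ (k : ℕ) : (k + 1) * (k + 1 + 1) / 2 = k * (k + 1) / 2 + (k + 1) := by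
  rw [show (k + 1) * (k + 1 + 1) = k * (k + 1) + (k + 1) * 2 by ring,
    Nat.add_mul_div_right _ _ two_pos]

theorem sum_qBinom_eq_sum_qPoch_mul_qBinom (N : ℕ) (q : ℂ)
    (hq : ∀ i : ℕ, 1 ≤ i → i ≤ N → q ^ i ≠ 1) (x y : ℂ)
    (hy : ∀ i : ℕ, 1 ≤ i → i ≤ N → y * q ^ i ≠ 1) :
    ∑ k ∈ Finset.range (N + 1), x ^ k * q ^ (k * (k + 1) / 2) / qPoch (y * q) q k * qBinom q N k
    = ∑ m ∈ Finset.range (N + 1),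
      x ^ m * q ^ (m * (m + 1) / 2) * qPoch (-(x * q ^ (m + 1))) q (N - m) *
        (y ^ m * q ^ (m ^ 2)) / qPoch (y * q) q m * qBinom q N m := by
  induction N generalizing x y with
  | zero => simp [qPoch]
  | succ n ih =>
    have hq' : ∀ i : ℕ, 1 ≤ i → i ≤ n → q ^ i ≠ 1 := fun i h1 h2 => hq i h1 (by omega)
    have hyq : ∀ i : ℕ, 1 ≤ i → i ≤ n → y * q * q ^ i ≠ 1 := fun i h1 h2 => by
      have := hy (i + 1) (by omega) (by omega)
      rwa [pow_succ', ← mul_assoc] at this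
    have h1 : 1 - y * q ≠ 0 :=
      sub_ne_zero.2 fun h => hy 1 le_rfl (by omega) (by rw [pow_one, h])
    have ih1 := ih hq' (x * q) y fun i h1 h2 => hy i h1 (by omega)
    have ih2 := ih hq' (x * q) (y * q) hyq
    rw [sum_mul_qBinom_succ hq, sum_mul_qBinom_succ hq]
    trans (∑ k ∈ Finset.range (n + 1),
        (x * q) ^ k * q ^ (k * (k + 1) / 2) / qPoch (y * q) q k * qBinom q n k) +
      x * q / (1 - y * q) * ∑ k ∈ Finset.range (n + 1),
        (x * q) ^ k * q ^ (k * (k + 1) / 2) / qPoch (y * q * q) q k * qBinom q n k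
    · rw [Finset.mul_sum, ← Finset.sum_add_distrib]
      refine Finset.sum_congr rfl fun k _ => ?_
      rw [triangular_succ, qPoch_succ_left]
      field_simp
      ring
    · rw [ih1, ih2, Finset.mul_sum, ← Finset.sum_add_distrib]
      refine Finset.sum_congr rfl fun m hm => ?_
      have hmn : m ≤ n := Nat.lt_succ_iff.1 (Finset.mem_range.1 hm)
      have hP : qPoch (y * q) q (m + 1) ≠ 0 :=
        qPoch_mul_self_ne_zero fun i h1 h2 => hy i h1 (by omega)
      have hP2 : qPoch (y * q * q) q m = qPoch (y * q) q (m + 1) / (1 - y * q) := by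
        rw [qPoch_succ_left]
        field_simp
      rw [qPoch_succ] at hP hP2
      obtain ⟨hPm, hm1⟩ := mul_ne_zero_iff.1 hP
      rw [hP2, triangular_succ, qPoch_succ, show n + 1 - m = n - m + 1 by omega,
        show n + 1 - (m + 1) = n - m by omega, qPoch_succ_left (-(x * q ^ (m + 1)))]
      rw [show -(x * q ^ (m + 1)) * q = -(x * q * q ^ (m + 1)) by ring,
        show -(x * q ^ (m + 1 + 1)) = -(x * q * q ^ (m + 1)) by ring]
      generalize qPoch (-(x * q * q ^ (m + 1))) q (n - m) = A
      generalize qPoch (y * q) q m = B at *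
      generalize qBinom q n m = C
      generalize m * (m + 1) / 2 = T
      generalize hD : 1 - y * q * q ^ m = D at *
      generalize 1 - y * q = E at *
      field_simp
      rw [← hD]
      ring

/-- Finite refinement of Ismail's identity (Theorem `ThmL`): for a nonnegative integer `N`
and `q, a, b, t` with `q^i ≠ 1` and `atq^i ≠ 1` for `1 ≤ i ≤ N`,
`Σ_{k=0}^N (bt)^k q^{k(k+1)/2}/(atq;q)_k [N choose k]_q
 = Σ_{m=0}^N (bt)^m q^{m(m+1)/2} (−btq^{m+1};q)_{N−m} (at)^m q^{m²}/(atq;q)_m [N choose m]_q`. -/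
theorem stmt9 (N : ℕ) (q a b t : ℂ)
    (hq : ∀ i : ℕ, 1 ≤ i → i ≤ N → q ^ i ≠ 1)
    (ha : ∀ i : ℕ, 1 ≤ i → i ≤ N → a * t * q ^ i ≠ 1) :
    ∑ k ∈ Finset.range (N + 1),
      (b * t) ^ k * q ^ (k * (k + 1) / 2) / qPoch (a * t * q) q k * qBinom q N k
    = ∑ m ∈ Finset.range (N + 1),
      (b * t) ^ m * q ^ (m * (m + 1) / 2) * qPoch (-(b * t * q ^ (m + 1))) q (N - m) *
        ((a * t) ^ m * q ^ (m ^ 2)) / qPoch (a * t * q) q m * qBinom q N m := by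
  exact sum_qBinom_eq_sum_qPoch_mul_qBinom N q hq (b * t) (a * t) ha
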